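/- arXiv:2411.16272 — 10 statements merged into one kernel-verified Lean document; each statement's English description precedes it below -/
import Mathlib

section
/- Let R be a commutative ring equipped with a derivation d : R → R (additive, satisfying the Leibniz rule), extended entrywise to vectors in Fin 2 → R and to 2×2 matrices over R. Define the symplectic pairing ω(u,v) = u 0 * v 1 − u 1 * v 0 for u, v : Fin 2 → R. Let F be a 2×2 matrix over R with det F = 1 (hence invertible, with inverse F⁻¹), let A be any 2×2 matrix over R, and let f, g : Fin 2 → R. Then ω( d(F⁻¹.mulVec f) + A.mulVec (F⁻¹.mulVec f) , F⁻¹.mulVec g ) = ω( d f + (−(dF) * F⁻¹ + F * A * F⁻¹).mulVec f , g ). (This is the algebraic identity underlying the lemma that gauge transformations F send the (d+A)-twisted Clifford pairing {f,g} = Res((d+A)f, g) to the F[d+A]-twisted pairing, where F[d+A] = d − (dF)F⁻¹ + FAF⁻¹.) -/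
open Matrix

/-- The standard symplectic pairing on `Fin 2 → R`. -/
def sympPairing {R : Type*} [CommRing R] (u v : Fin 2 → R) : R :=
  u 0 * v 1 - u 1 * v 0

theorem sympPairing_mulVec {R : Type*} [CommRing R] (F : Matrix (Fin 2) (Fin 2) R)
    (u v : Fin 2 → R) :
    sympPairing (F.mulVec u) (F.mulVec v) = F.det * sympPairing u v := by
  simp only [sympPairing, Matrix.mulVec, dotProduct, Fin.sum_univ_two, Matrix.det_fin_two]
  ring

theorem Derivation.comp_mulVec {R m n : Type*} [CommRing R] [Fintype n] (d : Derivation ℤ R R)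
    (F : Matrix m n R) (u : n → R) :
    (fun i => d (F.mulVec u i)) =
      F.mulVec (fun i => d (u i)) + (F.map (d : R → R)).mulVec u := by
  ext i
  simp only [Matrix.mulVec, dotProduct, map_sum, Derivation.leibniz, smul_eq_mul,
    Finset.sum_add_distrib, Pi.add_apply, Matrix.map_apply, mul_comm (u _)]

/-- Gauge transformations send the `(d+A)`-twisted Clifford pairing to the
`F[d+A]`-twisted pairing. -/
theorem gauge_pairing {R : Type*} [CommRing R] (d : Derivation ℤ R R)
    (F A : Matrix (Fin 2) (Fin 2) R) (hF : F.det = 1) (f g : Fin 2 → R) :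
    sympPairing
      ((fun i => d ((F⁻¹.mulVec f) i)) + A.mulVec (F⁻¹.mulVec f))
      (F⁻¹.mulVec g)
      =
    sympPairing
      ((fun i => d (f i)) +
        (-(F.map (d : R → R)) * F⁻¹ + F * A * F⁻¹).mulVec f)
      g := by
  have hu : IsUnit F.det := hF ▸ isUnit_one
  have mulVec_inv (w : Fin 2 → R) : F.mulVec (F⁻¹.mulVec w) = w := by
    rw [Matrix.mulVec_mulVec, Matrix.mul_nonsing_inv F hu, Matrix.one_mulVec]
  have hf := d.comp_mulVec F (F⁻¹.mulVec f)
  rw [mulVec_inv] at hf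
  rw [← one_mul (sympPairing _ (F⁻¹.mulVec g)), ← hF, ← sympPairing_mulVec, mulVec_inv, hf]
  congr 1
  simp only [Matrix.mulVec_add, Matrix.add_mulVec, ← Matrix.mulVec_mulVec, Matrix.neg_mulVec]
  abel
end

section
/- Let K be a field and V a K-vector space. Let x be an element of the exterior algebra ExteriorAlgebra K V (the Clifford algebra of the zero quadratic form on V). Suppose that for every linear functional d : V →ₗ[K] K, the left contraction (interior product) d ⌋ x equals 0. Then x is a scalar, i.e. x lies in the range of the algebra map K → ExteriorAlgebra K V. -/
namespace ExteriorAlgebra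

/-- The transvection-like map `w ↦ w - d w • v` acts on the exterior algebra by
`x ↦ x - v ∧ (d ⌋ x)`. -/
theorem map_id_sub_smulRight {R M : Type*} [CommRing R] [AddCommGroup M] [Module R M]
    (d : Module.Dual R M) (v : M) (x : ExteriorAlgebra R M) :
    map (LinearMap.id - d.smulRight v) x =
      x - ι R v * CliffordAlgebra.contractLeft (Q := (0 : QuadraticForm R M)) d x := by
  induction x using CliffordAlgebra.left_induction with
  | algebraMap r =>
    rw [CliffordAlgebra.contractLeft_algebraMap, mul_zero, sub_zero]
    exact AlgHom.commutes _ r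
  | add x y hx hy => rw [map_add, map_add, hx, hy, mul_add, add_sub_add_comm]
  | ι_mul x w hx =>
    rw [map_mul, hx, CliffordAlgebra.contractLeft_ι_mul]
    change map _ (ι R w) * _ = ι R w * x - ι R v * (d w • x - ι R w * _)
    generalize CliffordAlgebra.contractLeft (Q := (0 : QuadraticForm R M)) d x = y
    have hv : ι R v * (ι R v * y) = 0 := by rw [← mul_assoc, ι_sq_zero, zero_mul]
    have hw : ι R w * (ι R v * y) = -(ι R v * (ι R w * y)) := by
      rw [← mul_assoc, ← mul_assoc, eq_neg_iff_add_eq_zero, ← add_mul, ι_add_mul_swap, zero_mul]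
    simp only [map_apply_ι, LinearMap.sub_apply, LinearMap.id_apply, LinearMap.smulRight_apply,
      map_sub, map_smul, sub_mul, mul_sub, smul_mul_assoc, mul_smul_comm, hv, hw, smul_zero]
    abel

section Basis

variable {R M I : Type*} [CommRing R] [AddCommGroup M] [Module R M] (b : Module.Basis I R M)

theorem map_id_sub_sum_coord_eq_self (x : ExteriorAlgebra R M)
    (h : ∀ i, CliffordAlgebra.contractLeft (Q := (0 : QuadraticForm R M)) (b.coord i) x = 0)
    (T : Finset I) :
    map (LinearMap.id - ∑ i ∈ T, (b.coord i).smulRight (b i)) x = x := by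
  classical
  induction T using Finset.induction_on with
  | empty => simp
  | insert j T hj ih =>
    have hcomp : LinearMap.id - ∑ i ∈ insert j T, (b.coord i).smulRight (b i) =
        (LinearMap.id - ∑ i ∈ T, (b.coord i).smulRight (b i)) ∘ₗ
          (LinearMap.id - (b.coord j).smulRight (b j)) := by
      have hsum : (∑ i ∈ T, (b.coord i).smulRight (b i)) (b j) = 0 := by
        rw [LinearMap.sum_apply]
        refine Finset.sum_eq_zero fun i hi ↦ ?_
        rw [LinearMap.smulRight_apply, b.coord_apply, b.repr_self,
          Finsupp.single_eq_of_ne (by rintro rfl; exact hj hi), zero_smul]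
      rw [Finset.sum_insert hj]
      generalize ∑ i ∈ T, (b.coord i).smulRight (b i) = A at hsum
      ext w
      simp only [LinearMap.comp_apply, LinearMap.sub_apply, LinearMap.id_apply,
        LinearMap.add_apply, LinearMap.smulRight_apply, map_sub, map_smul, hsum, sub_zero]
      abel
    rw [hcomp, ← map_comp_map, AlgHom.comp_apply, map_id_sub_smulRight, h, mul_zero, sub_zero, ih]

theorem exists_map_id_sub_sum_coord_mem_bot (x : ExteriorAlgebra R M) :
    ∃ S : Finset I, ∀ T, S ⊆ T →
      map (LinearMap.id - ∑ i ∈ T, (b.coord i).smulRight (b i)) x ∈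
        (⊥ : Subalgebra R (ExteriorAlgebra R M)) := by
  classical
  induction x using ExteriorAlgebra.induction with
  | algebraMap r =>
    exact ⟨∅, fun T _ ↦ by rw [AlgHom.commutes]; exact Subalgebra.algebraMap_mem _ r⟩
  | ι v =>
    refine ⟨(b.repr v).support, fun T hT ↦ ?_⟩
    have hv : ∑ i ∈ T, b.repr v i • b i = v := by
      refine Eq.trans ?_ (b.linearCombination_repr v)
      rw [Finsupp.linearCombination_apply,
        Finsupp.sum_of_support_subset _ hT _ fun i _ ↦ zero_smul R (b i)]
    simp [LinearMap.sum_apply, hv]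
  | mul x y hx hy =>
    obtain ⟨S, hS⟩ := hx
    obtain ⟨S', hS'⟩ := hy
    refine ⟨S ∪ S', fun T hT ↦ ?_⟩
    rw [map_mul]
    exact mul_mem (hS T (Finset.union_subset_left hT)) (hS' T (Finset.union_subset_right hT))
  | add x y hx hy =>
    obtain ⟨S, hS⟩ := hx
    obtain ⟨S', hS'⟩ := hy
    refine ⟨S ∪ S', fun T hT ↦ ?_⟩
    rw [map_add]
    exact add_mem (hS T (Finset.union_subset_left hT)) (hS' T (Finset.union_subset_right hT))

end Basis

end ExteriorAlgebra

/-- If an element of the exterior algebra is annihilated by the left contraction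
with every linear functional, then it is a scalar. -/
theorem scalar_of_contractLeft_eq_zero {K : Type*} [Field K] {V : Type*}
    [AddCommGroup V] [Module K V] (x : ExteriorAlgebra K V)
    (h : ∀ d : Module.Dual K V,
      CliffordAlgebra.contractLeft (Q := (0 : QuadraticForm K V)) d x = 0) :
    x ∈ Set.range (algebraMap K (ExteriorAlgebra K V)) := by
  let b := Module.Basis.ofVectorSpace K V
  obtain ⟨S, hS⟩ := ExteriorAlgebra.exists_map_id_sub_sum_coord_mem_bot b x
  have hx := hS S subset_rfl
  rw [ExteriorAlgebra.map_id_sub_sum_coord_eq_self b x fun i ↦ h (b.coord i)] at hx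
  exact Algebra.mem_bot.mp hx
end

section
/- Define h : ℤ → ℤ → ℚ by h i j = 1 if i > j, h i j = 1/2 if i = j, and h i j = 0 if i < j. For all integers m, n, a, the function i ↦ h i (a − i) − h (n − a + i) (m − i) from ℤ to ℚ has finite support, and its sum over all i ∈ ℤ (as a finsum) equals (m − n)/2. -/
/-- The half-indicator step function `1_{i ≳ j}`. -/
noncomputable def halfInd (i j : ℤ) : ℚ :=
  if i > j then 1 else if i = j then 1/2 else 0

/-- Raising the threshold of the half-indicator at even integers by one lowers it by `1/2`
at exactly one point. -/
theorem halfInd_two_mul_sub_succ (c : ℤ) :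
    (fun i : ℤ => halfInd (2 * i) c - halfInd (2 * i) (c + 1)) = Pi.single ((c + 1) / 2) (1 / 2) := by
  funext i
  rw [Pi.single_apply]
  unfold halfInd
  split_ifs <;> first | omega | norm_num

theorem halfInd_two_mul_sub_succ_support_finite (c : ℤ) :
    (Function.support fun i : ℤ => halfInd (2 * i) c - halfInd (2 * i) (c + 1)).Finite := by
  rw [halfInd_two_mul_sub_succ]
  exact (Set.finite_singleton _).subset Pi.support_single_subset

theorem finsum_halfInd_two_mul_sub_succ (c : ℤ) :
    ∑ᶠ i : ℤ, (halfInd (2 * i) c - halfInd (2 * i) (c + 1)) = 1 / 2 := by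
  simp_rw [congrFun (halfInd_two_mul_sub_succ c)]
  rw [finsum_eq_single _ ((c + 1) / 2) fun i hi => Pi.single_eq_of_ne hi _, Pi.single_eq_same]

/-- The half-indicators at even integers with thresholds `a` and `a + d` differ at finitely many
points, by `d / 2` in total. -/
theorem finsum_halfInd_two_mul_sub_add (a d : ℤ) :
    (Function.support fun i : ℤ => halfInd (2 * i) a - halfInd (2 * i) (a + d)).Finite ∧
    ∑ᶠ i : ℤ, (halfInd (2 * i) a - halfInd (2 * i) (a + d)) = d / 2 := by
  induction d using Int.induction_on with
  | zero => simp
  | succ k ih =>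
    obtain ⟨hf, hs⟩ := ih
    have hf' := halfInd_two_mul_sub_succ_support_finite (a + k)
    have key : (fun i : ℤ => halfInd (2 * i) a - halfInd (2 * i) (a + (k + 1))) = fun i =>
        (halfInd (2 * i) a - halfInd (2 * i) (a + k)) +
          (halfInd (2 * i) (a + k) - halfInd (2 * i) (a + k + 1)) := by
      funext i
      rw [← add_assoc a]
      ring
    rw [key, finsum_add_distrib hf hf', hs, finsum_halfInd_two_mul_sub_succ]
    refine ⟨(hf.union hf').subset (Function.support_add _ _), ?_⟩
    push_cast
    ring
  | pred k ih =>
    obtain ⟨hf, hs⟩ := ih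
    have hf' := halfInd_two_mul_sub_succ_support_finite (a + (-k - 1))
    have key : (fun i : ℤ => halfInd (2 * i) a - halfInd (2 * i) (a + (-k - 1))) = fun i =>
        (halfInd (2 * i) a - halfInd (2 * i) (a + -k)) -
          (halfInd (2 * i) (a + (-k - 1)) - halfInd (2 * i) (a + (-k - 1) + 1)) := by
      funext i
      rw [show a + (-(k : ℤ) - 1) + 1 = a + -k by ring]
      ring
    rw [key, finsum_sub_distrib hf hf', hs, finsum_halfInd_two_mul_sub_succ]
    refine ⟨(hf.union hf').subset (Function.support_sub _ _), ?_⟩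
    push_cast
    ring

/-- The half-indicator depends only on the difference of its arguments. -/
theorem halfInd_congr {i j k l : ℤ} (h : i - j = k - l) : halfInd i j = halfInd k l := by
  unfold halfInd
  split_ifs <;> first | omega | rfl

/-- The counting identity (part f of the Virasoro-relation computation): the sum
over `i ∈ ℤ` of `1_{i ≳ a−i} − 1_{n−a+i ≳ m−i}` is finite and equals `(m−n)/2`. -/
theorem halfInd_sum_eq (m n a : ℤ) :
    (Function.support fun i : ℤ =>
        halfInd i (a - i) - halfInd (n - a + i) (m - i)).Finite ∧
    ∑ᶠ i : ℤ, (halfInd i (a - i) - halfInd (n - a + i) (m - i)) = (m - n) / 2 := by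
  have h₁ (i : ℤ) : halfInd i (a - i) = halfInd (2 * i) a := halfInd_congr (by ring)
  have h₂ (i : ℤ) : halfInd (n - a + i) (m - i) = halfInd (2 * i) (a + (m - n)) :=
    halfInd_congr (by ring)
  simp_rw [h₁, h₂]
  exact_mod_cast finsum_halfInd_two_mul_sub_add a (m - n)
end

section
/- Define h : ℤ → ℤ → ℚ by h i j = 1 if i > j, h i j = 1/2 if i = j, and h i j = 0 if i < j. For every integer m, the function i ↦ ((m − i) * (−i) : ℚ) * ( h i (−i) − h (i − m) (m − i) ) from ℤ to ℚ has finite support, and its sum over all i ∈ ℤ (as a finsum) equals −(m³ − m)/6. -/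
theorem sum_range_mul_sub (n : ℕ) (c : ℚ) :
    ∑ k ∈ Finset.range n, (k : ℚ) * (c - k) =
      n * (n - 1) * (3 * c - (2 * n - 1)) / 6 := by
  induction n with
  | zero => simp
  | succ n ih =>
    rw [Finset.sum_range_succ, ih]
    push_cast
    ring

theorem finsum_eq_sum_range_of_support_subset {f : ℤ → ℚ} {g : ℕ → ℤ}
    (hg : Function.Injective g) {n : ℕ}
    (hf : ∀ i, f i ≠ 0 → ∃ k < n, g k = i) :
    f.support.Finite ∧ ∑ᶠ i, f i = ∑ k ∈ Finset.range n, f (g k) := by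
  have hs : f.support ⊆ ((Finset.range n).image g : Finset ℤ) := fun i hi => by
    simpa using hf i hi
  exact ⟨(Finset.finite_toSet _).subset hs, by
    rw [finsum_eq_sum_of_support_subset f hs, Finset.sum_image hg.injOn]⟩

theorem halfInd_anomaly_term_of_nonneg {m i : ℤ} (hm : 0 ≤ m) :
    (((m - i : ℤ) : ℚ) * ((-i : ℤ) : ℚ)) *
        (halfInd i (-i) - halfInd (i - m) (m - i)) =
      if 0 ≤ i ∧ i < m then -((i : ℚ) * (m - i)) else 0 := by
  rcases eq_or_ne i 0 with rfl | hi
  · simp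
  rcases eq_or_ne i m with rfl | him
  · simp
  unfold halfInd
  push_cast
  split_ifs <;> first | omega | ring

theorem halfInd_neg_left_self (i : ℤ) : halfInd (-i) i = 1 - halfInd i (-i) := by
  unfold halfInd
  split_ifs <;> first | omega | norm_num

theorem halfInd_anomaly_term_neg (m i : ℤ) :
    (((-m - i : ℤ) : ℚ) * ((-i : ℤ) : ℚ)) *
        (halfInd i (-i) - halfInd (i - -m) (-m - i)) =
      -((((m - -i : ℤ) : ℚ) * ((- -i : ℤ) : ℚ)) *
        (halfInd (-i) (- -i) - halfInd (-i - m) (m - -i))) := by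
  have h := halfInd_neg_left_self (i + m)
  rw [show i - -m = i + m by ring, show -m - i = -(i + m) by ring,
    show -i - m = -(i + m) by ring, show m - -i = i + m by ring, neg_neg, h,
    halfInd_neg_left_self i]
  push_cast
  ring

/-- The anomaly computation (part d of the Virasoro-relation proof): the sum over
`i ∈ ℤ` of `(m−i)(−i)(1_{i ≳ −i} − 1_{i−m ≳ m−i})` is finite and equals
`−(m³−m)/6`, the central term at central charge `c = −2`. -/
theorem halfInd_anomaly_sum (m : ℤ) :
    (Function.support fun i : ℤ =>
        (((m - i : ℤ) : ℚ) * ((-i : ℤ) : ℚ)) *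
          (halfInd i (-i) - halfInd (i - m) (m - i))).Finite ∧
    ∑ᶠ i : ℤ, (((m - i : ℤ) : ℚ) * ((-i : ℤ) : ℚ)) *
        (halfInd i (-i) - halfInd (i - m) (m - i))
      = -((m : ℚ) ^ 3 - (m : ℚ)) / 6 := by
  obtain ⟨n, rfl | rfl⟩ := m.eq_nat_or_neg
  · have ht (i : ℤ) := halfInd_anomaly_term_of_nonneg (i := i) (Int.natCast_nonneg n)
    simp only [ht]
    obtain ⟨hfin, hsum⟩ := finsum_eq_sum_range_of_support_subset (n := n)
      (f := fun i : ℤ => if 0 ≤ i ∧ i < n then -((i : ℚ) * ((n : ℤ) - i)) else 0)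
      Nat.cast_injective fun i hi => by
        obtain ⟨h0, hn⟩ := of_not_not fun h => hi (if_neg h)
        exact ⟨i.toNat, by omega, by omega⟩
    refine ⟨hfin, hsum.trans ?_⟩
    rw [Finset.sum_congr rfl fun k hk =>
      if_pos ⟨Int.natCast_nonneg k, by simpa using hk⟩]
    simp only [Int.cast_natCast, Finset.sum_neg_distrib, sum_range_mul_sub]
    ring
  · have ht (i : ℤ) := (halfInd_anomaly_term_neg n i).trans
      (congrArg _ (halfInd_anomaly_term_of_nonneg (i := -i) (Int.natCast_nonneg n)))
    simp only [ht]
    obtain ⟨hfin, hsum⟩ := finsum_eq_sum_range_of_support_subset (n := n)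
      (f := fun i : ℤ =>
        -(if 0 ≤ -i ∧ -i < n then -(((-i : ℤ) : ℚ) * ((n : ℤ) - (-i : ℤ))) else 0))
      (neg_injective.comp Nat.cast_injective) fun i hi => by
        obtain ⟨h0, hn⟩ := of_not_not fun h => hi (neg_eq_zero.mpr (if_neg h))
        exact ⟨(-i).toNat, by omega, by simp only [Function.comp_apply]; omega⟩
    refine ⟨hfin, hsum.trans ?_⟩
    simp only [Function.comp_apply, neg_neg]
    rw [Finset.sum_congr rfl fun k hk => congrArg _ (
      if_pos ⟨Int.natCast_nonneg k, by simpa using hk⟩)]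
    simp only [Int.cast_natCast, Int.cast_neg, neg_neg, sum_range_mul_sub]
    ring
end

section
/- For natural numbers n, A, B, let p(n, A, B) denote the number of partitions of n into at most A parts, each part of size at most B (the coefficient of qⁿ in the Gaussian binomial coefficient [A+B choose A]_q). Write T(j) = j(j−1)/2. Then for all natural numbers k, M, N, m with k ≤ M: p(m, M−k, N+k) = Σ_{x=0}^{min(N, M−k)} Σ_{n₁, n₂ ≥ 0, n₁ + n₂ + T(k+x) + T(x) + x = m + T(k)} p(n₁, k+x, M−k−x) · p(n₂, x, N−x). -/
/-- `restrictedPartitions n A B` is the number of partitions of `n` into at most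
`A` parts, each of size at most `B` (the coefficient of `qⁿ` in the Gaussian
binomial coefficient `[A+B choose A]_q`). -/
noncomputable def restrictedPartitions (n A B : ℕ) : ℕ :=
  Nat.card {π : n.Partition // Multiset.card π.parts ≤ A ∧ ∀ i ∈ π.parts, i ≤ B}

/-- The triangular number `T(j) = j(j−1)/2`. -/
def tri (j : ℕ) : ℕ := j * (j - 1) / 2

open Polynomial in
/-- The Gaussian binomial coefficient `[n choose j]_q` as a polynomial in `q = X`, defined by
the `q`-Pascal recursion. -/
noncomputable def gaussianBinomial : ℕ → ℕ → ℕ[X]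
  | _, 0 => 1
  | 0, _ + 1 => 0
  | n + 1, j + 1 => gaussianBinomial n (j + 1) + X ^ (n - j) * gaussianBinomial n j

namespace gaussianBinomial

open Polynomial

@[simp] lemma zero_right (n : ℕ) : gaussianBinomial n 0 = 1 := by
  cases n <;> rw [gaussianBinomial]

lemma succ_succ (n j : ℕ) : gaussianBinomial (n + 1) (j + 1) =
    gaussianBinomial n (j + 1) + X ^ (n - j) * gaussianBinomial n j := by
  rw [gaussianBinomial]

lemma eq_zero_of_lt {n j : ℕ} (h : n < j) : gaussianBinomial n j = 0 := by
  induction n generalizing j with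
  | zero =>
    obtain ⟨j, rfl⟩ := Nat.exists_eq_succ_of_ne_zero h.ne'
    rw [gaussianBinomial]
  | succ n ih =>
    obtain ⟨j, rfl⟩ : ∃ i, j = i + 1 := ⟨j - 1, by omega⟩
    rw [succ_succ, ih (by omega), ih (by omega), mul_zero, add_zero]

@[simp] lemma self (n : ℕ) : gaussianBinomial n n = 1 := by
  induction n with
  | zero => simp
  | succ n ih => rw [succ_succ, eq_zero_of_lt n.lt_succ_self, ih]; simp

/-- The dual `q`-Pascal recursion. -/
lemma succ_succ' (n j : ℕ) : gaussianBinomial (n + 1) (j + 1) =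
    gaussianBinomial n j + X ^ (j + 1) * gaussianBinomial n (j + 1) := by
  induction n generalizing j with
  | zero =>
    cases j with
    | zero => rw [eq_zero_of_lt (show 0 < 0 + 1 by omega)]; simp
    | succ j => simp [eq_zero_of_lt]
  | succ n ih =>
    rcases lt_or_ge n j with h | h
    · rw [eq_zero_of_lt (show n + 1 < j + 1 by omega), mul_zero, add_zero, succ_succ,
        eq_zero_of_lt (show n + 1 < j + 1 by omega), zero_add, Nat.sub_eq_zero_of_le (by omega),
        pow_zero, one_mul]
    · obtain ⟨d, rfl⟩ := Nat.exists_eq_add_of_le h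
      rw [succ_succ (j + d + 1) j, show j + d + 1 - j = d + 1 by omega]
      conv_lhs => rw [ih j]
      rw [succ_succ (j + d) j, Nat.add_sub_cancel_left]
      cases j with
      | zero => simp only [zero_right]; ring
      | succ j =>
        have h₁ : gaussianBinomial (j + 1 + d + 1) (j + 1) = gaussianBinomial (j + 1 + d) (j + 1) +
            X ^ (d + 1) * gaussianBinomial (j + 1 + d) j := by
          rw [succ_succ, show j + 1 + d - j = d + 1 by omega]
        calc _ = gaussianBinomial (j + 1 + d) (j + 1) +
              X ^ (j + 1 + 1) * gaussianBinomial (j + 1 + d) (j + 1 + 1) +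
              X ^ (d + 1) * (gaussianBinomial (j + 1 + d) j +
                X ^ (j + 1) * gaussianBinomial (j + 1 + d) (j + 1)) := by rw [← ih j]
          _ = _ := by rw [h₁]; ring

lemma symm_add (a b : ℕ) : gaussianBinomial (a + b) a = gaussianBinomial (a + b) b := by
  induction hn : a + b generalizing a b with
  | zero =>
    obtain ⟨rfl, rfl⟩ : a = 0 ∧ b = 0 := by omega
    rfl
  | succ n ih =>
    rcases a with _ | a
    · obtain rfl : b = n + 1 := by omega
      simp
    rcases b with _ | b
    · obtain rfl : a = n := by omega
      simp
    rw [succ_succ, succ_succ', ih (a + 1) b (by omega), ih a (b + 1) (by omega),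
      show n - a = b + 1 by omega]

/-- The `q`-Vandermonde identity. -/
theorem vandermonde (a k N : ℕ) : gaussianBinomial (a + k + N) a =
    ∑ x ∈ Finset.range (N + 1),
      X ^ (x * (k + x)) * gaussianBinomial (a + k) (k + x) * gaussianBinomial N x := by
  induction N generalizing a k with
  | zero => simpa using symm_add a k
  | succ N ih =>
    rcases a with _ | a
    · rw [Finset.sum_range_succ', Finset.sum_eq_zero fun x _ => by
        rw [eq_zero_of_lt (show 0 + k < k + (x + 1) by omega)]; simp]
      simp
    have hsum : ∑ x ∈ Finset.range (N + 1 + 1), X ^ (x * (k + x)) *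
          gaussianBinomial (a + 1 + k) (k + x) * gaussianBinomial (N + 1) x =
        ∑ x ∈ Finset.range (N + 1 + 1), X ^ (x * (k + x)) *
          gaussianBinomial (a + 1 + k) (k + x) * gaussianBinomial N x +
        X ^ (N + k + 1) * ∑ x ∈ Finset.range (N + 1), X ^ (x * (k + 1 + x)) *
          gaussianBinomial (a + (k + 1)) (k + 1 + x) * gaussianBinomial N x := by
      rw [Finset.sum_range_succ', Finset.sum_range_succ' _ (N + 1), Finset.mul_sum,
        add_right_comm (Finset.sum _ _), ← Finset.sum_add_distrib]
      congr 1
      · refine Finset.sum_congr rfl fun x hx => ?_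
        obtain ⟨d, rfl⟩ := Nat.exists_eq_add_of_le (Finset.mem_range_succ_iff.mp hx)
        rw [succ_succ, Nat.add_sub_cancel_left, show a + (k + 1) = a + 1 + k by omega,
          show k + 1 + x = k + (x + 1) by omega]
        ring
      · simp
    rw [hsum, ← ih, Finset.sum_range_succ, eq_zero_of_lt N.lt_succ_self, mul_zero, add_zero, ← ih,
      show a + 1 + k + (N + 1) = a + 1 + k + N + 1 by omega, succ_succ,
      show a + 1 + k + N - a = N + k + 1 by omega, show a + (k + 1) + N = a + 1 + k + N by omega]

end gaussianBinomial

/-- The multisets of parts of the partitions counted by `restrictedPartitions n A B`. -/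
def restrictedParts (n A B : ℕ) : Set (Multiset ℕ) :=
  {s | s.sum = n ∧ Multiset.card s ≤ A ∧ ∀ i ∈ s, 0 < i ∧ i ≤ B}

/-- Partitions with restricted parts are determined by their multiset of parts. -/
def restrictedPartsEquiv (n A B : ℕ) :
    {π : n.Partition // Multiset.card π.parts ≤ A ∧ ∀ i ∈ π.parts, i ≤ B} ≃
      restrictedParts n A B where
  toFun π := ⟨π.1.parts, π.1.parts_sum, π.2.1, fun i hi => ⟨π.1.parts_pos hi, π.2.2 i hi⟩⟩
  invFun s := ⟨⟨s.1, fun {i} hi => (s.2.2.2 i hi).1, s.2.1⟩, s.2.2.1, fun i hi => (s.2.2.2 i hi).2⟩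
  left_inv _ := rfl
  right_inv _ := rfl

lemma restrictedPartitions_eq_ncard (n A B : ℕ) :
    restrictedPartitions n A B = (restrictedParts n A B).ncard :=
  Nat.card_congr (restrictedPartsEquiv n A B)

lemma restrictedParts_finite (n A B : ℕ) : (restrictedParts n A B).Finite :=
  Set.finite_coe_iff.mp (Finite.of_equiv _ (restrictedPartsEquiv n A B))

lemma restrictedPartitions_of_forall_eq_zero {n A B : ℕ}
    (h : ∀ s ∈ restrictedParts n A B, s = 0) :
    restrictedPartitions n A B = if n = 0 then 1 else 0 := by
  rw [restrictedPartitions_eq_ncard]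
  split_ifs with hn
  · rw [Set.ncard_eq_one]
    refine ⟨0, Set.eq_singleton_iff_unique_mem.mpr ⟨?_, h⟩⟩
    simp [restrictedParts, hn]
  · rw [Set.ncard_eq_zero (restrictedParts_finite n A B), Set.eq_empty_iff_forall_notMem]
    intro s hs
    have := hs.1
    rw [h s hs, Multiset.sum_zero] at this
    exact hn this.symm

lemma restrictedPartitions_zero_left (n B : ℕ) :
    restrictedPartitions n 0 B = if n = 0 then 1 else 0 :=
  restrictedPartitions_of_forall_eq_zero fun s hs => by simpa using hs.2.1

lemma restrictedPartitions_zero_right (n A : ℕ) :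
    restrictedPartitions n A 0 = if n = 0 then 1 else 0 :=
  restrictedPartitions_of_forall_eq_zero fun s hs =>
    Multiset.eq_zero_of_forall_notMem fun i hi => by have := hs.2.2 i hi; omega

/-- Split according to whether a part of the largest allowed size occurs. -/
lemma restrictedPartitions_succ_succ (n A B : ℕ) :
    restrictedPartitions n (A + 1) (B + 1) = restrictedPartitions n (A + 1) B +
      if B + 1 ≤ n then restrictedPartitions (n - (B + 1)) A (B + 1) else 0 := by
  simp only [restrictedPartitions_eq_ncard]
  have hmem : ∀ s ∈ restrictedParts n (A + 1) (B + 1), B + 1 ∉ s →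
      s ∈ restrictedParts n (A + 1) B := fun s hs h =>
    ⟨hs.1, hs.2.1, fun i hi => ⟨(hs.2.2 i hi).1, by
      have := (hs.2.2 i hi).2
      have : i ≠ B + 1 := fun h' => h (h' ▸ hi)
      omega⟩⟩
  have hmono : restrictedParts n (A + 1) B ⊆ restrictedParts n (A + 1) (B + 1) := fun s hs =>
    ⟨hs.1, hs.2.1, fun i hi => ⟨(hs.2.2 i hi).1, (hs.2.2 i hi).2.trans B.le_succ⟩⟩
  split_ifs with hn
  · rw [← Set.ncard_image_of_injective (restrictedParts (n - (B + 1)) A (B + 1))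
      (f := Multiset.cons (B + 1)) fun _ _ h => (Multiset.cons_inj_right _).mp h,
      ← Set.ncard_union_eq _ (restrictedParts_finite _ _ _) ((restrictedParts_finite _ _ _).image _)]
    · congr 1
      refine Set.Subset.antisymm (fun s hs => ?_) (Set.union_subset hmono ?_)
      · by_cases h : B + 1 ∈ s
        · obtain ⟨t, rfl⟩ := Multiset.exists_cons_of_mem h
          obtain ⟨h₁, h₂, h₃⟩ := hs
          rw [Multiset.sum_cons] at h₁
          rw [Multiset.card_cons] at h₂
          exact Or.inr ⟨t, ⟨by omega, by omega, fun i hi =>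
            h₃ i (Multiset.mem_cons_of_mem hi)⟩, rfl⟩
        · exact Or.inl (hmem s hs h)
      · rintro _ ⟨t, ⟨h₁, h₂, h₃⟩, rfl⟩
        refine ⟨by rw [Multiset.sum_cons]; omega, by rw [Multiset.card_cons]; omega,
          fun i hi => ?_⟩
        rcases Multiset.mem_cons.mp hi with rfl | hi
        · omega
        · exact h₃ i hi
    · rw [Set.disjoint_left]
      rintro _ hs ⟨t, -, rfl⟩
      have := hs.2.2 (B + 1) (Multiset.mem_cons_self _ _)
      omega
  · rw [add_zero]
    congr 1
    refine Set.Subset.antisymm (fun s hs => hmem s hs fun h => hn ?_) hmono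
    exact hs.1 ▸ Multiset.le_sum_of_mem h

lemma coeff_gaussianBinomial (A B n : ℕ) :
    (gaussianBinomial (A + B) A).coeff n = restrictedPartitions n A B := by
  induction A generalizing B n with
  | zero => rw [restrictedPartitions_zero_left, gaussianBinomial.zero_right, Polynomial.coeff_one]
  | succ A ihA =>
    induction B generalizing n with
    | zero =>
      rw [restrictedPartitions_zero_right, add_zero, gaussianBinomial.self, Polynomial.coeff_one]
    | succ B ihB =>
      rw [restrictedPartitions_succ_succ, ← ihB, ← ihA, ← add_assoc, gaussianBinomial.succ_succ,
        Polynomial.coeff_add, Polynomial.coeff_X_pow_mul', show A + 1 + B - A = B + 1 by omega,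
        show A + 1 + B = A + (B + 1) by omega]

lemma Polynomial.coeff_X_pow_mul_mul {R : Type*} [Semiring R] (f g : Polynomial R) {d m L : ℕ}
    (hm : m < L) : (X ^ d * f * g).coeff m =
      ∑ n₁ ∈ Finset.range L, ∑ n₂ ∈ Finset.range L,
        if n₁ + n₂ + d = m then f.coeff n₁ * g.coeff n₂ else 0 := by
  rw [← Finset.sum_product', ← Finset.sum_filter, mul_assoc, coeff_X_pow_mul']
  split_ifs with h
  · rw [coeff_mul]
    refine Finset.sum_congr ?_ fun _ _ => rfl
    ext ⟨i, j⟩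
    rw [Finset.HasAntidiagonal.mem_antidiagonal, Finset.mem_filter, Finset.mem_product,
      Finset.mem_range, Finset.mem_range]
    omega
  · refine (Finset.sum_eq_zero fun p hp => ?_).symm
    have := (Finset.mem_filter.mp hp).2
    omega

lemma tri_add_tri_add (k x : ℕ) : tri (k + x) + tri x + x = tri k + x * (k + x) := by
  have h : ∀ j, tri (j + 1) = tri j + j := Nat.triangle_succ
  induction x with
  | zero => simp [tri]
  | succ x ih =>
    rw [← add_assoc k, h, h]
    linarith

/-- The first character identity (coefficient-wise `q`-Vandermonde identity):
`q^{T(k)} [M+N choose M−k]_q = Σ_x q^{T(k+x)} [M choose k+x]_q ·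
q^{T(x)} [N choose x]_q · q^x`. -/
theorem character_identity_one (k M N m : ℕ) (hk : k ≤ M) :
    restrictedPartitions m (M - k) (N + k) =
      ∑ x ∈ Finset.range (min N (M - k) + 1),
        ∑ n₁ ∈ Finset.range (m + tri k + 1),
          ∑ n₂ ∈ Finset.range (m + tri k + 1),
            if n₁ + n₂ + tri (k + x) + tri x + x = m + tri k then
              restrictedPartitions n₁ (k + x) (M - k - x) *
                restrictedPartitions n₂ x (N - x)
            else 0 := by
  obtain ⟨a, rfl⟩ := Nat.exists_eq_add_of_le' hk
  rw [Nat.add_sub_cancel, ← coeff_gaussianBinomial, show a + (N + k) = a + k + N by omega,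
    gaussianBinomial.vandermonde, Polynomial.finsetSum_coeff]
  refine (Finset.sum_subset (Finset.range_mono (by omega)) fun x hx hx' => ?_).symm.trans
    (Finset.sum_congr rfl fun x hx => ?_)
  · rw [Finset.mem_range] at hx hx'
    rw [gaussianBinomial.eq_zero_of_lt (show a + k < k + x by omega)]
    simp
  · rw [Finset.mem_range] at hx
    rw [Polynomial.coeff_X_pow_mul_mul _ _ (show m < m + tri k + 1 by omega)]
    refine Finset.sum_congr rfl fun n₁ _ => Finset.sum_congr rfl fun n₂ _ => ?_
    rw [← coeff_gaussianBinomial, ← coeff_gaussianBinomial,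
      show k + x + (a - x) = a + k by omega, show x + (N - x) = N by omega]
    have := tri_add_tri_add k x
    exact if_congr (by omega) rfl rfl
end

section
/- Let k, N be natural numbers and let X be a multiset of natural numbers (the parts of a partition) such that every element of X is at most k + N. Let x be the greatest natural number x ≤ N such that X has at least x elements of size ≥ k + x (such x exists since x = 0 always works). Then there exists a unique pair of multisets (Y, Z) with X = Y + Z, every element of Y at most k + x, every element of Z at least k + x, and Z having exactly x elements. -/
namespace Multiset

/-- The elements that are at least `c` are those exceeding `c`, and the copies of `c`. -/
theorem filter_le_eq_filter_lt_add_replicate (X : Multiset ℕ) (c : ℕ) :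
    X.filter (fun a => c ≤ a) = X.filter (fun a => c < a) + replicate (X.count c) c := by
  ext a
  simp only [count_add, count_filter, count_replicate]
  grind

/-- A multiset splits uniquely at height `c` with `n` elements in its upper half, provided `n` lies
between the number of elements exceeding `c` and the number of elements that are at least `c`. -/
theorem existsUnique_split (X : Multiset ℕ) (c n : ℕ)
    (hlt : card (X.filter fun a => c < a) ≤ n) (hle : n ≤ card (X.filter fun a => c ≤ a)) :
    ∃! YZ : Multiset ℕ × Multiset ℕ,
      X = YZ.1 + YZ.2 ∧ (∀ a ∈ YZ.1, a ≤ c) ∧ (∀ a ∈ YZ.2, c ≤ a) ∧ card YZ.2 = n := by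
  rw [filter_le_eq_filter_lt_add_replicate, card_add, card_replicate] at hle
  obtain ⟨m, rfl⟩ := Nat.exists_eq_add_of_le hlt
  have hm : m ≤ X.count c := by lia
  refine ⟨(X.filter (fun a => a < c) + replicate (X.count c - m) c,
    X.filter (fun a => c < a) + replicate m c), ⟨?_, ?_, ?_, ?_⟩, ?_⟩
  · ext a
    simp only [count_add, count_filter, count_replicate]
    grind
  · intro a ha
    rcases mem_add.1 ha with ha | ha
    · exact (of_mem_filter ha).le
    · exact (eq_of_mem_replicate ha).le
  · intro a ha
    rcases mem_add.1 ha with ha | ha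
    · exact (of_mem_filter ha).le
    · exact (eq_of_mem_replicate ha).ge
  · simp
  · rintro ⟨Y, Z⟩ ⟨hX, hY, hZ, hcard⟩
    dsimp only at hX hY hZ hcard
    subst hX
    have hYlt : Y.filter (fun a => c < a) = 0 :=
      filter_eq_nil.2 fun a ha => (hY a ha).not_gt
    have hZlt : Z.filter (fun a => a < c) = 0 :=
      filter_eq_nil.2 fun a ha => (hZ a ha).not_gt
    have hZsplit := filter_le_eq_filter_lt_add_replicate Z c
    rw [filter_eq_self.2 hZ] at hZsplit
    have hZm : Z.count c = m := by
      have := congrArg card hZsplit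
      rw [card_add, card_replicate] at this
      rw [filter_add, hYlt, zero_add] at hcard
      lia
    have hYsplit : Y = Y.filter (fun a => a < c) + replicate (Y.count c) c := by
      ext a
      have : c < a → Y.count a = 0 := fun h => count_eq_zero.2 fun ha => (hY a ha).not_gt h
      simp only [count_add, count_filter, count_replicate]
      grind
    rw [filter_add, filter_add, hYlt, hZlt, zero_add, add_zero, count_add, hZm,
      Nat.add_sub_cancel, ← hYsplit, ← hZm, ← hZsplit]

end Multiset


/-- Constructive decomposition of partitions: if `X` is a multiset of naturals
with all parts at most `k + N`, and `x` is the greatest natural `x ≤ N` such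
that `X` has at least `x` elements of size `≥ k + x`, then `X` decomposes
uniquely as `Y + Z` with all parts of `Y` at most `k + x` and `Z` consisting of
exactly `x` parts, each at least `k + x`. -/
theorem multiset_partition_decomposition (k N : ℕ) (X : Multiset ℕ)
    (hX : ∀ a ∈ X, a ≤ k + N) (x : ℕ) (hxN : x ≤ N)
    (hx : x ≤ Multiset.card (X.filter fun a => k + x ≤ a))
    (hmax : ∀ y : ℕ, y ≤ N → y ≤ Multiset.card (X.filter fun a => k + y ≤ a) →
      y ≤ x) :
    ∃! YZ : Multiset ℕ × Multiset ℕ,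
      X = YZ.1 + YZ.2 ∧ (∀ a ∈ YZ.1, a ≤ k + x) ∧
        (∀ a ∈ YZ.2, k + x ≤ a) ∧ Multiset.card YZ.2 = x := by
  refine X.existsUnique_split (k + x) x ?_ hx
  rcases hxN.eq_or_lt with rfl | hlt
  · rw [Multiset.filter_eq_nil.2 fun a ha => (hX a ha).not_gt]
    simp
  · by_contra! h
    exact absurd (hmax (x + 1) hlt h) (by lia)
end

section
/- Let R be a commutative ring, t, n natural numbers, x : Fin t → R a family of elements, and e : Fin t → ℕ a family of exponents. Then (Σ_{j : Fin t} (x j)^n) · det (fun i j => (x j)^(e i)) = Σ_{i₀ : Fin t} det (fun i j => (x j)^(e i + if i = i₀ then n else 0)). In words: multiplying the generalized Vandermonde-type determinant det((x_j)^{e_i}) by the power sum p_n = Σ_j x_jⁿ equals the sum over rows i₀ of the determinant in which the exponent e_{i₀} is increased by n. -/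
open Matrix

/-- Multiplying the generalized Vandermonde-type determinant `det((x_j)^{e_i})`
by the power sum `p_n = Σ_j x_jⁿ` equals the sum over rows `i₀` of the
determinant in which the exponent `e_{i₀}` is increased by `n`. -/
theorem powerSum_mul_det {R : Type*} [CommRing R] (t n : ℕ)
    (x : Fin t → R) (e : Fin t → ℕ) :
    (∑ j : Fin t, x j ^ n) * (Matrix.of fun i j : Fin t => x j ^ e i).det =
      ∑ i₀ : Fin t,
        (Matrix.of fun i j : Fin t =>
          x j ^ (e i + if i = i₀ then n else 0)).det := by
  simp only [det_apply', Matrix.of_apply]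
  rw [Finset.sum_comm, Finset.mul_sum]
  refine Finset.sum_congr rfl fun σ _ => ?_
  conv_rhs => rw [← Equiv.sum_comp σ]
  rw [Finset.sum_mul]
  refine Finset.sum_congr rfl fun k _ => ?_
  have h : ∏ j, x j ^ (if j = k then n else 0) = x k ^ n := by
    simp [pow_ite]
  simp only [pow_add, Finset.prod_mul_distrib, σ.injective.eq_iff, h]
  ring
end

section
/- Let ξ, ε, τ be complex numbers with ξ ≠ 0. Define 2×2 complex matrices Ξ = ((ξ,0),(0,−ξ)), Λ = ((ε,0),(0,−ε)), N = ((0,τ),(0,0)), and define Φ₀ = 1 (the identity matrix) and, for n ≥ 1, Φₙ = (−2ξ)^(−n) · τ · (∏_{j=1}^{n−1} (2ε + j)) · ((0,1),(0,0)). Then for every natural number n: n·Φₙ + (Ξ·Φₙ₊₁ − Φₙ₊₁·Ξ) + (Λ·Φₙ − Φₙ·Λ) + N·Φₙ = 0. -/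
open Matrix Finset

/-- The explicit coefficients `Φₙ` of the formal power series gauge
transformation solve the recursion
`n Φₙ + [Ξ, Φₙ₊₁] + [Λ, Φₙ] + N Φₙ = 0` conjugating the irregular connection
`∂ + Ξ/z² + (Λ+N)/z` to its Birkhoff normal form. -/
theorem formal_recursion_solution (ξ ε τ : ℂ) (hξ : ξ ≠ 0)
    (Ξ Λ N : Matrix (Fin 2) (Fin 2) ℂ)
    (hΞ : Ξ = !![ξ, 0; 0, -ξ]) (hΛ : Λ = !![ε, 0; 0, -ε])
    (hN : N = !![0, τ; 0, 0])
    (Φ : ℕ → Matrix (Fin 2) (Fin 2) ℂ)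
    (hΦ0 : Φ 0 = 1)
    (hΦ : ∀ n : ℕ, 1 ≤ n →
      Φ n = ((-2 * ξ) ^ (-(n : ℤ)) * τ *
        ∏ j ∈ Finset.Icc 1 (n - 1), (2 * ε + (j : ℂ))) • !![0, 1; 0, 0]) :
    ∀ n : ℕ,
      (n : ℂ) • Φ n + (Ξ * Φ (n + 1) - Φ (n + 1) * Ξ) +
        (Λ * Φ n - Φ n * Λ) + N * Φ n = 0 := by
  have h2 : -2 * ξ ≠ 0 := mul_ne_zero (by norm_num) hξ
  rintro (_ | m)
  · rw [hΦ0, hΦ (0 + 1) le_rfl, hΞ, hΛ, hN]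
    ext i j
    fin_cases i <;> fin_cases j <;> simp
    field_simp
    ring
  · have step : -2 * ξ * ((-2 * ξ) ^ (-((m + 1 + 1 : ℕ) : ℤ)) * τ *
          ∏ j ∈ Finset.Icc 1 (m + 1), (2 * ε + (j : ℂ))) =
        (2 * ε + ((m + 1 : ℕ) : ℂ)) * ((-2 * ξ) ^ (-((m + 1 : ℕ) : ℤ)) * τ *
          ∏ j ∈ Finset.Icc 1 m, (2 * ε + (j : ℂ))) := by
      rw [Finset.prod_Icc_succ_top (by omega), _root_.zpow_neg, _root_.zpow_neg,
        _root_.zpow_natCast, _root_.zpow_natCast, pow_succ (-2 * ξ) (m + 1), mul_inv]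
      linear_combination ((-2 * ξ) ^ (m + 1))⁻¹ * τ *
        (∏ j ∈ Finset.Icc 1 m, (2 * ε + (j : ℂ))) * (2 * ε + ((m + 1 : ℕ) : ℂ)) *
        mul_inv_cancel₀ h2
    rw [hΦ (m + 1) (by omega), hΦ (m + 1 + 1) (by omega), hΞ, hΛ, hN]
    simp only [Nat.add_sub_cancel]
    generalize (-2 * ξ) ^ (-((m + 1 + 1 : ℕ) : ℤ)) * τ *
      ∏ j ∈ Finset.Icc 1 (m + 1), (2 * ε + (j : ℂ)) = c' at step ⊢
    generalize (-2 * ξ) ^ (-((m + 1 : ℕ) : ℤ)) * τ *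
      ∏ j ∈ Finset.Icc 1 m, (2 * ε + (j : ℂ)) = c at step ⊢
    ext i j
    fin_cases i <;> fin_cases j <;> simp
    push_cast at step
    linear_combination -step
end

section
/- Let ξ, ε, τ be real numbers with ξ > 0. For x > 0 define B(x) = −τ · exp(2ξ/x) · x^(−2ε) · ∫_{t ∈ (0, x)} exp(−2ξ/t) · t^(2ε−1) dt. Then for every x > 0 the integrand t ↦ exp(−2ξ/t)·t^(2ε−1) is integrable on the interval (0, x), and B has derivative at x equal to −( 2·(ξ/x² + ε/x)·B(x) + τ/x ); that is, B solves the ordinary differential equation B′(x) + 2(ξ/x² + ε/x)·B(x) + τ/x = 0 on (0, ∞). -/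
open Real MeasureTheory

/-- The variation-of-constants solution
`B(x) = −τ e^{2ξ/x} x^{−2ε} ∫₀ˣ e^{−2ξ/t} t^{2ε−1} dt`. -/
noncomputable def Bsol (ξ ε τ : ℝ) (x : ℝ) : ℝ :=
  -τ * Real.exp (2 * ξ / x) * x ^ (-2 * ε) *
    ∫ t in Set.Ioo (0 : ℝ) x, Real.exp (-2 * ξ / t) * t ^ (2 * ε - 1)

open Filter Topology in
/-- `e^{-b/t} t^s` is flat at the origin from the right when `b > 0`. -/
theorem tendsto_exp_neg_div_mul_rpow_nhdsGT_zero (s : ℝ) {b : ℝ} (hb : 0 < b) :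
    Tendsto (fun t : ℝ => Real.exp (-b / t) * t ^ s) (𝓝[>] 0) (𝓝 0) := by
  refine ((tendsto_rpow_mul_exp_neg_mul_atTop_nhds_zero (-s) b hb).comp
    tendsto_inv_nhdsGT_zero).congr' ?_
  filter_upwards [self_mem_nhdsWithin] with t ht
  have ht : 0 < t := ht
  simp only [Function.comp_apply]
  rw [Real.inv_rpow ht.le, Real.rpow_neg ht.le, inv_inv, mul_comm, div_eq_mul_inv]

theorem continuousAt_exp_div_mul_rpow (a s : ℝ) {x : ℝ} (hx : x ≠ 0) :
    ContinuousAt (fun t : ℝ => Real.exp (a / t) * t ^ s) x :=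
  (continuousAt_const.div continuousAt_id hx).rexp.mul
    (continuousAt_id.rpow_const (Or.inl hx))

theorem integrableOn_Ioo_exp_neg_div_mul_rpow (s : ℝ) {b x : ℝ} (hb : 0 < b) (hx : 0 < x) :
    IntegrableOn (fun t : ℝ => Real.exp (-b / t) * t ^ s) (Set.Ioo 0 x) := by
  have hcont : ContinuousOn (fun t : ℝ => Real.exp (-b / t) * t ^ s) (Set.Ioo 0 x) :=
    fun t ht => (continuousAt_exp_div_mul_rpow (-b) s ht.1.ne').continuousWithinAt
  have hext := continuousOn_Icc_extendFrom_Ioo hcont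
    (tendsto_exp_neg_div_mul_rpow_nhdsGT_zero s hb)
    ((continuousAt_exp_div_mul_rpow (-b) s hx.ne').tendsto.mono_left nhdsWithin_le_nhds)
  refine (hext.integrableOn_Icc.mono_set Set.Ioo_subset_Icc_self).congr_fun
    (fun t ht => ?_) measurableSet_Ioo
  refine extendFrom_eq (by rw [closure_Ioo hx.ne]; exact Set.Ioo_subset_Icc_self ht) ?_
  exact (continuousAt_exp_div_mul_rpow (-b) s ht.1.ne').tendsto.mono_left nhdsWithin_le_nhds

open Filter Topology in
theorem hasDerivAt_integral_Ioo_exp_neg_div_mul_rpow (s : ℝ) {b x : ℝ} (hb : 0 < b)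
    (hx : 0 < x) :
    HasDerivAt (fun u : ℝ => ∫ t in Set.Ioo (0 : ℝ) u, Real.exp (-b / t) * t ^ s)
      (Real.exp (-b / x) * x ^ s) x := by
  have hint : IntervalIntegrable (fun t : ℝ => Real.exp (-b / t) * t ^ s) volume 0 x :=
    (intervalIntegrable_iff_integrableOn_Ioo_of_le hx.le).2
      (integrableOn_Ioo_exp_neg_div_mul_rpow s hb hx)
  have hmeas : Measurable fun t : ℝ => Real.exp (-b / t) * t ^ s := by fun_prop
  refine (intervalIntegral.integral_hasDerivAt_right hint
    hmeas.stronglyMeasurable.stronglyMeasurableAtFilter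
    (continuousAt_exp_div_mul_rpow (-b) s hx.ne')).congr_of_eventuallyEq ?_
  filter_upwards [Ioi_mem_nhds hx] with u hu
  rw [intervalIntegral.integral_of_le (le_of_lt hu), integral_Ioc_eq_integral_Ioo]

/-- For `ξ > 0`, the integrand is integrable on `(0,x)` for every `x > 0`, and
`B` solves the ODE `B′(x) + 2(ξ/x² + ε/x) B(x) + τ/x = 0` on `(0,∞)`. -/
theorem Bsol_solves_ODE (ξ ε τ : ℝ) (hξ : 0 < ξ) :
    ∀ x : ℝ, 0 < x →
      IntegrableOn (fun t : ℝ => Real.exp (-2 * ξ / t) * t ^ (2 * ε - 1))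
        (Set.Ioo (0 : ℝ) x) ∧
      HasDerivAt (Bsol ξ ε τ)
        (-(2 * (ξ / x ^ 2 + ε / x) * Bsol ξ ε τ x + τ / x)) x := by
  intro x hx
  have hb : 0 < 2 * ξ := by positivity
  have hI := hasDerivAt_integral_Ioo_exp_neg_div_mul_rpow (2 * ε - 1) hb hx
  have hint := integrableOn_Ioo_exp_neg_div_mul_rpow (2 * ε - 1) hb hx
  simp only [← neg_mul] at hI hint
  refine ⟨hint, ?_⟩
  have hE : HasDerivAt (fun y : ℝ => Real.exp (2 * ξ / y))
      (Real.exp (2 * ξ / x) * (2 * ξ * -(x ^ 2)⁻¹)) x := by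
    simpa only [div_eq_mul_inv] using ((hasDerivAt_inv hx.ne').const_mul (2 * ξ)).exp
  have hP := Real.hasDerivAt_rpow_const (x := x) (p := -2 * ε) (Or.inl hx.ne')
  refine (((hE.const_mul (-τ)).mul hP).mul hI).congr_deriv ?_
  have hexp : Real.exp (2 * ξ / x) * Real.exp (-2 * ξ / x) = 1 := by
    rw [← Real.exp_add, neg_mul, neg_div, add_neg_cancel, Real.exp_zero]
  have hpow : x ^ (-2 * ε) * x ^ (2 * ε - 1) = x⁻¹ := by
    rw [← Real.rpow_add hx, ← Real.rpow_neg_one]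
    congr 1
    ring
  have hpow' : x ^ (-2 * ε - 1) = x ^ (-2 * ε) * x⁻¹ := by
    rw [Real.rpow_sub_one hx.ne', div_eq_mul_inv]
  rw [Bsol, hpow']
  simp only [div_eq_mul_inv, Pi.mul_apply] at hexp ⊢
  rw [← inv_pow]
  linear_combination (-τ * x ^ (-2 * ε) * x ^ (2 * ε - 1)) * hexp - τ * hpow
end

section
/- Let ξ, ε, τ be complex numbers with ξ ≠ 0, τ ≠ 0, and 2ε + n ≠ 0 for every natural number n ≥ 1. For n ≥ 1 define Bₙ = τ · (∏_{j=1}^{n−1} (2ε + j)) · (−2ξ)^(−n), and B₀ = 0. Then for every complex number z ≠ 0, the series Σₙ Bₙ·zⁿ is not summable, i.e. ¬ Summable (fun n => Bₙ * zⁿ). -/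
open Finset
open Filter

/-- The formal power series solution of the irregular connection has radius of
convergence `0`: for `ξ ≠ 0`, `τ ≠ 0` and `2ε` not a negative integer, the
series `Σₙ Bₙ zⁿ` with `Bₙ = τ (2ε+1)⋯(2ε+n−1) (−2ξ)^{−n}` diverges for every
`z ≠ 0`. -/
theorem formal_series_not_summable (ξ ε τ : ℂ) (hξ : ξ ≠ 0) (hτ : τ ≠ 0)
    (hε : ∀ n : ℕ, 1 ≤ n → 2 * ε + (n : ℂ) ≠ 0)
    (B : ℕ → ℂ) (hB0 : B 0 = 0)
    (hB : ∀ n : ℕ, 1 ≤ n →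
      B n = τ * (∏ j ∈ Finset.Icc 1 (n - 1), (2 * ε + (j : ℂ))) *
        (-2 * ξ) ^ (-(n : ℤ))) :
    ∀ z : ℂ, z ≠ 0 → ¬ Summable (fun n : ℕ => B n * z ^ n) := by
  intro z hz
  have hc : (-2 * ξ)⁻¹ * z ≠ 0 := by simp [hξ, hz]
  have hB_ne (n : ℕ) (hn : 1 ≤ n) : B n ≠ 0 := by
    rw [hB n hn]
    refine mul_ne_zero (mul_ne_zero hτ ?_) (zpow_ne_zero _ (by simp [hξ]))
    exact Finset.prod_ne_zero_iff.mpr fun j hj => hε j (Finset.mem_Icc.mp hj).1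
  have hB_succ (n : ℕ) (hn : 1 ≤ n) :
      B (n + 1) = B n * ((2 * ε + n) * (-2 * ξ)⁻¹) := by
    obtain ⟨m, rfl⟩ := Nat.exists_eq_add_of_le' hn
    rw [hB _ hn, hB _ (Nat.le_add_left 1 (m + 1)), Nat.add_sub_cancel, Nat.add_sub_cancel,
      Finset.prod_Icc_succ_top (Nat.le_add_left 1 m), zpow_neg, zpow_neg, zpow_natCast,
      zpow_natCast, pow_succ _ (m + 1), mul_inv]
    ring
  have h_ratio : Tendsto (fun n : ℕ => ‖2 * ε + n‖ * ‖(-2 * ξ)⁻¹ * z‖) atTop atTop :=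
    (tendsto_norm_cobounded_atTop.comp
      ((tendsto_const_add_cobounded (2 * ε)).comp
        tendsto_natCast_atTop_cobounded)).atTop_mul_const (norm_pos_iff.mpr hc)
  refine not_summable_of_ratio_norm_eventually_ge one_lt_two ?_ ?_
  · refine Eventually.frequently ?_
    filter_upwards [eventually_ge_atTop 1] with n hn
    exact norm_ne_zero_iff.mpr (mul_ne_zero (hB_ne n hn) (pow_ne_zero n hz))
  · filter_upwards [eventually_ge_atTop 1, h_ratio.eventually_ge_atTop 2] with n hn h2
    calc 2 * ‖B n * z ^ n‖
        ≤ ‖2 * ε + n‖ * ‖(-2 * ξ)⁻¹ * z‖ * ‖B n * z ^ n‖ := by gcongr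
      _ = ‖B (n + 1) * z ^ (n + 1)‖ := by
        rw [hB_succ n hn, ← norm_mul, ← norm_mul]
        congr 1
        ring
end
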